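/- (Residue of the boundary-correction term, k = 0, 1.) Fix r_0 > 0, k ∈ {0, 1}, and r ≥ r_0. Let f : (r_0, ∞) → ℂ be measurable with √s·f(s) ∈ L¹(r_0, ∞); for k = 0 assume additionally that s·(1 + |ln s|)·f(s) ∈ L¹(r_0, ∞). For τ > 0 define G(τ) = (K_k(√τ·r)·I_{k−1}(√τ·r_0)/K_{k−1}(√τ·r_0))·∫_{r_0}^∞ f(s)·K_k(√τ·s)·s ds. Then lim_{τ→0+} τ·G(τ) = 0. -/

import Mathlib

open Complex Set Filter MeasureTheory

/-- Modified Bessel function of the first kind `I_k`. -/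
noncomputable def besselI (k : ℕ) (x : ℝ) : ℝ :=
  ∑' m : ℕ, (x / 2) ^ (2 * m + k) / (Nat.factorial m * Nat.factorial (m + k))

/-- Modified Bessel function of the second kind `K_k`. -/
noncomputable def besselK (k : ℕ) (x : ℝ) : ℝ :=
  ∫ t in Set.Ioi (0 : ℝ), Real.exp (-x * Real.cosh t) * Real.cosh (k * t)

/-- `I_{k−1}`, with the convention `I_{−1} = I_1`. -/
noncomputable def besselIm1 (k : ℕ) : ℝ → ℝ :=
  if k = 0 then besselI 1 else besselI (k - 1)

/-- `K_{k−1}`, with the convention `K_{−1} = K_1`. -/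
noncomputable def besselKm1 (k : ℕ) : ℝ → ℝ :=
  if k = 0 then besselK 1 else besselK (k - 1)

/-- The boundary-correction term `G(τ)` of the resolvent. -/
noncomputable def correctionTerm (r₀ : ℝ) (k : ℕ) (f : ℝ → ℂ) (r τ : ℝ) : ℂ :=
  ((besselK k (Real.sqrt τ * r) : ℂ) * (besselIm1 k (Real.sqrt τ * r₀) : ℂ)
      / (besselKm1 k (Real.sqrt τ * r₀) : ℂ)) *
    ∫ s in Set.Ioi r₀, f s * (besselK k (Real.sqrt τ * s) : ℂ) * (s : ℂ)

lemma bk_dom (y : ℝ) (hy : 0 < y) :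
    IntegrableOn (fun t => Real.cosh t * Real.exp (-y * Real.sinh t)) (Ioi (0:ℝ)) ∧
    ∫ t in Ioi (0:ℝ), Real.cosh t * Real.exp (-y * Real.sinh t) = 1 / y := by
  have hd : ∀ t ∈ Ici (0:ℝ), HasDerivAt (fun t => -(1 / y) * Real.exp (-y * Real.sinh t))
      (Real.cosh t * Real.exp (-y * Real.sinh t)) t := by
    intro t _
    have h := (((Real.hasDerivAt_sinh t).const_mul (-y)).exp).const_mul (-(1 / y))
    refine h.congr_deriv ?_
    have hy' : y ≠ 0 := hy.ne'
    field_simp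
  have hnn : ∀ t ∈ Ioi (0:ℝ), 0 ≤ Real.cosh t * Real.exp (-y * Real.sinh t) := by
    intro t _
    have := Real.cosh_pos t
    positivity
  have hs : Tendsto Real.sinh atTop atTop := by
    refine tendsto_atTop_mono' _ ?_ tendsto_id
    filter_upwards [eventually_ge_atTop 0] with t ht
    exact Real.self_le_sinh_iff.2 ht
  have hl : Tendsto (fun t => -(1 / y) * Real.exp (-y * Real.sinh t)) atTop (nhds 0) := by
    have h1 : Tendsto (fun t => -y * Real.sinh t) atTop atBot :=
      hs.const_mul_atTop_of_neg (by linarith)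
    simpa using (Real.tendsto_exp_atBot.comp h1).const_mul (-(1 / y))
  refine ⟨integrableOn_Ioi_deriv_of_nonneg' hd hnn hl, ?_⟩
  rw [integral_Ioi_of_hasDerivAt_of_nonneg' hd hnn hl]
  simp

lemma bk_ptw (k : ℕ) (hk : k ≤ 1) (y : ℝ) (hy : 0 < y) (t : ℝ) :
    Real.exp (-y * Real.cosh t) * Real.cosh (k * t) ≤
      Real.cosh t * Real.exp (-y * Real.sinh t) := by
  have h1 : Real.cosh (k * t) ≤ Real.cosh t := by
    interval_cases k <;> simp [Real.one_le_cosh]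
  have h2 : Real.exp (-y * Real.cosh t) ≤ Real.exp (-y * Real.sinh t) := by
    apply Real.exp_le_exp.2
    nlinarith [Real.sinh_lt_cosh t]
  rw [mul_comm]
  exact mul_le_mul h1 h2 (Real.exp_pos _).le (Real.cosh_pos _).le

lemma bk_int (k : ℕ) (hk : k ≤ 1) (y : ℝ) (hy : 0 < y) :
    IntegrableOn (fun t => Real.exp (-y * Real.cosh t) * Real.cosh (k * t)) (Ioi (0:ℝ)) := by
  refine Integrable.mono' (bk_dom y hy).1 ?_ ?_
  · exact Continuous.aestronglyMeasurable (by fun_prop)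
  · refine Eventually.of_forall fun t => ?_
    rw [Real.norm_of_nonneg (mul_nonneg (Real.exp_pos _).le (Real.cosh_pos _).le)]
    exact bk_ptw k hk y hy t

lemma bk_nonneg (k : ℕ) (y : ℝ) : 0 ≤ besselK k y :=
  integral_nonneg fun _ => mul_nonneg (Real.exp_pos _).le (Real.cosh_pos _).le

lemma bk_le (k : ℕ) (hk : k ≤ 1) (y : ℝ) (hy : 0 < y) : besselK k y ≤ 1 / y := by
  rw [← (bk_dom y hy).2]
  exact integral_mono (bk_int k hk y hy) (bk_dom y hy).1 (bk_ptw k hk y hy)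

lemma bk_zero_le_one (y z : ℝ) (hy : 0 < y) (hyz : y ≤ z) : besselK 0 z ≤ besselK 1 y := by
  refine integral_mono (bk_int 0 (by simp) z (by linarith)) (bk_int 1 le_rfl y hy) fun t => ?_
  have h : Real.exp (-z * Real.cosh t) ≤ Real.exp (-y * Real.cosh t) := by
    apply Real.exp_le_exp.2
    nlinarith [Real.cosh_pos t]
  refine mul_le_mul h ?_ (Real.cosh_pos _).le (Real.exp_pos _).le
  simp [Real.one_le_cosh]

lemma bk_lower (T y : ℝ) (hT : 0 ≤ T) (hy : 0 < y) :
    T * Real.exp (-y * Real.cosh T) ≤ besselK 0 y := by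
  have h1 : ∫ t in Ioc (0:ℝ) T, Real.exp (-y * Real.cosh T) ≤ 
      ∫ t in Ioc (0:ℝ) T, Real.exp (-y * Real.cosh t) * Real.cosh ((0:ℕ) * t) := by
    refine setIntegral_mono_on (by simp) ((bk_int 0 (by simp) y hy).mono_set Ioc_subset_Ioi_self)
      measurableSet_Ioc fun t ht => ?_
    simp only [Nat.cast_zero, zero_mul, Real.cosh_zero, mul_one]
    apply Real.exp_le_exp.2
    have : Real.cosh t ≤ Real.cosh T := by
      rw [Real.cosh_le_cosh, abs_of_pos ht.1, abs_of_nonneg hT]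
      exact ht.2
    nlinarith
  have h2 : ∫ t in Ioc (0:ℝ) T, Real.exp (-y * Real.cosh t) * Real.cosh ((0:ℕ) * t) ≤
      besselK 0 y := by
    refine setIntegral_mono_set (bk_int 0 (by simp) y hy) ?_
      (Eventually.of_forall Ioc_subset_Ioi_self)
    exact Eventually.of_forall fun t => mul_nonneg (Real.exp_pos _).le (Real.cosh_pos _).le
  refine le_trans (le_of_eq ?_) (h1.trans h2)
  simp [hT]

lemma bk_tendsto : Tendsto (besselK 0) (nhdsWithin 0 (Ioi 0)) atTop := by
  rw [tendsto_atTop]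
  intro b
  have hc : Tendsto (fun y : ℝ => (|b| + 1) * Real.exp (-y * Real.cosh (|b| + 1)))
      (nhdsWithin 0 (Ioi 0)) (nhds (|b| + 1)) := by
    refine tendsto_nhdsWithin_of_tendsto_nhds ?_
    refine Continuous.tendsto' (by fun_prop) _ _ (by simp)
  have hb : b < |b| + 1 := by linarith [le_abs_self b]
  filter_upwards [hc.eventually_const_lt hb, self_mem_nhdsWithin] with y h1 h2
  exact h1.le.trans (bk_lower _ y (by positivity) h2)

lemma bi_nonneg (k : ℕ) (y : ℝ) (hy : 0 ≤ y) : 0 ≤ besselI k y :=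
  tsum_nonneg fun m => by positivity

lemma bi_le (k : ℕ) (y : ℝ) (hy : 0 ≤ y) :
    besselI k y ≤ (y / 2) ^ k * Real.exp ((y / 2) ^ 2) := by
  have hs : HasSum (fun m : ℕ => (y / 2) ^ k * (((y / 2) ^ 2) ^ m / (Nat.factorial m : ℝ)))
      ((y / 2) ^ k * Real.exp ((y / 2) ^ 2)) := by
    have h := NormedSpace.expSeries_div_hasSum_exp (𝔸 := ℝ) ((y / 2) ^ 2)
    rw [← Real.exp_eq_exp_ℝ] at h
    exact h.mul_left ((y / 2) ^ k)
  have hle : ∀ m : ℕ, (y / 2) ^ (2 * m + k) / ((Nat.factorial m : ℝ) * Nat.factorial (m + k)) ≤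
      (y / 2) ^ k * (((y / 2) ^ 2) ^ m / (Nat.factorial m : ℝ)) := by
    intro m
    have h1 : (1:ℝ) ≤ Nat.factorial (m + k) := by exact_mod_cast Nat.factorial_pos _
    have h0 : (0:ℝ) < Nat.factorial m := by exact_mod_cast Nat.factorial_pos _
    rw [← mul_div_assoc, ← pow_mul, ← pow_add, add_comm k]
    exact div_le_div_of_nonneg_left (by positivity) h0 (by nlinarith)
  rw [← hs.tsum_eq]
  exact (Summable.of_nonneg_of_le (fun m => by positivity) hle hs.summable).tsum_le_tsum hle
    hs.summable

lemma int_bound (r₀ : ℝ) (hr₀ : 0 < r₀) (k : ℕ) (hk : k ≤ 1) (f : ℝ → ℂ)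
    (hL1 : IntegrableOn (fun s : ℝ => (Real.sqrt s : ℂ) * f s) (Set.Ioi r₀)) :
    ∃ M : ℝ, 0 ≤ M ∧ ∀ x : ℝ, 0 < x →
      ‖∫ s in Set.Ioi r₀, f s * (besselK k (x * s) : ℂ) * (s : ℂ)‖ ≤ M / x := by
  have hq : 0 < Real.sqrt r₀ := Real.sqrt_pos.2 hr₀
  refine ⟨∫ s in Set.Ioi r₀, ‖(Real.sqrt s : ℂ) * f s‖ / Real.sqrt r₀,
    integral_nonneg fun _ => by positivity, fun x hx => ?_⟩
  rw [← integral_div]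
  refine norm_integral_le_of_norm_le ((hL1.norm.div_const _).div_const _) ?_
  filter_upwards [ae_restrict_mem measurableSet_Ioi] with s hs
  have hs' : r₀ < s := hs
  have hs0 : 0 < s := hr₀.trans hs'
  have hK := bk_le k hk (x * s) (by positivity)
  have hsq : Real.sqrt r₀ ≤ Real.sqrt s := Real.sqrt_le_sqrt hs'.le
  rw [norm_mul, norm_mul, norm_mul, Complex.norm_real, Complex.norm_real, Complex.norm_real,
    Real.norm_of_nonneg (bk_nonneg _ _), Real.norm_of_nonneg hs0.le,
    Real.norm_of_nonneg (Real.sqrt_nonneg _)]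
  calc ‖f s‖ * besselK k (x * s) * s ≤ ‖f s‖ * (1 / (x * s)) * s := by gcongr
    _ = ‖f s‖ / x := by field_simp
    _ ≤ Real.sqrt s * ‖f s‖ / Real.sqrt r₀ / x := by
      gcongr
      rw [le_div_iff₀ hq, mul_comm]
      gcongr

theorem residue_correctionTerm_le_one (r₀ : ℝ) (hr₀ : 0 < r₀) (k : ℕ) (hk : k = 0 ∨ k = 1)
    (r : ℝ) (hr : r₀ ≤ r) (f : ℝ → ℂ)
    (hL1 : IntegrableOn (fun s : ℝ => (Real.sqrt s : ℂ) * f s) (Set.Ioi r₀))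
    (hL0 : k = 0 → IntegrableOn
      (fun s : ℝ => ((s * (1 + |Real.log s|) : ℝ) : ℂ) * f s) (Set.Ioi r₀)) :
    Tendsto (fun τ : ℝ => (τ : ℂ) * correctionTerm r₀ k f r τ)
      (nhdsWithin 0 (Set.Ioi 0)) (nhds 0) := by
  have hk1 : k ≤ 1 := by omega
  obtain ⟨M, hM, hint⟩ := int_bound r₀ hr₀ k hk1 f hL1
  have hr' : 0 < r := hr₀.trans_le hr
  have key : ∀ τ : ℝ, 0 < τ → ‖(τ : ℂ) * correctionTerm r₀ k f r τ‖ ≤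
      τ * (besselK k (Real.sqrt τ * r) * besselIm1 k (Real.sqrt τ * r₀) /
        besselKm1 k (Real.sqrt τ * r₀) * (M / Real.sqrt τ)) := by
    intro τ hτ
    have hx : 0 < Real.sqrt τ := Real.sqrt_pos.2 hτ
    have hI : 0 ≤ besselIm1 k (Real.sqrt τ * r₀) := by
      unfold besselIm1
      split_ifs <;> exact bi_nonneg _ _ (by positivity)
    have hK : 0 ≤ besselKm1 k (Real.sqrt τ * r₀) := by
      unfold besselKm1
      split_ifs <;> exact bk_nonneg _ _
    have hK2 := bk_nonneg k (Real.sqrt τ * r)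
    unfold correctionTerm
    rw [norm_mul, norm_mul, norm_div, norm_mul, Complex.norm_real, Complex.norm_real,
      Complex.norm_real, Complex.norm_real, Real.norm_of_nonneg hτ.le, Real.norm_of_nonneg hI,
      Real.norm_of_nonneg hK, Real.norm_of_nonneg hK2]
    have := hint _ hx
    gcongr
  have hexp : Tendsto (fun τ : ℝ => Real.exp ((Real.sqrt τ * r₀ / 2) ^ 2))
      (nhdsWithin 0 (Set.Ioi 0)) (nhds 1) :=
    tendsto_nhdsWithin_of_tendsto_nhds
      (Continuous.tendsto' (by fun_prop) _ _ (by simp))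
  rcases hk with rfl | rfl
  · have hid : Tendsto (fun τ : ℝ => τ) (nhdsWithin 0 (Set.Ioi 0)) (nhds 0) :=
      tendsto_nhdsWithin_of_tendsto_nhds tendsto_id
    have hlim : Tendsto (fun τ : ℝ => τ * (r₀ / 2 * M) * Real.exp ((Real.sqrt τ * r₀ / 2) ^ 2))
        (nhdsWithin 0 (Set.Ioi 0)) (nhds 0) := by
      simpa using (hid.mul_const (r₀ / 2 * M)).mul hexp
    refine squeeze_zero_norm' ?_ hlim
    filter_upwards [self_mem_nhdsWithin] with τ hτ
    have hτ' : 0 < τ := hτ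
    have hx : 0 < Real.sqrt τ := Real.sqrt_pos.2 hτ'
    refine (key τ hτ').trans ?_
    simp only [besselIm1, besselKm1, if_true]
    have hI := bi_le 1 (Real.sqrt τ * r₀) (by positivity)
    have hI0 := bi_nonneg 1 (Real.sqrt τ * r₀) (by positivity)
    have hK : besselK 0 (Real.sqrt τ * r) / besselK 1 (Real.sqrt τ * r₀) ≤ 1 :=
      div_le_one_of_le₀ (bk_zero_le_one _ _ (by positivity) (by gcongr)) (bk_nonneg _ _)
    calc _ = τ * (besselK 0 (Real.sqrt τ * r) / besselK 1 (Real.sqrt τ * r₀) *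
          besselI 1 (Real.sqrt τ * r₀) * (M / Real.sqrt τ)) := by ring
      _ ≤ τ * (1 * ((Real.sqrt τ * r₀ / 2) ^ 1 * Real.exp ((Real.sqrt τ * r₀ / 2) ^ 2)) *
          (M / Real.sqrt τ)) := by gcongr
      _ = _ := by field_simp
  · have hsq : Tendsto (fun τ : ℝ => Real.sqrt τ * r₀) (nhdsWithin 0 (Set.Ioi 0))
        (nhdsWithin 0 (Set.Ioi 0)) := by
      refine tendsto_nhdsWithin_iff.2 ⟨tendsto_nhdsWithin_of_tendsto_nhds
        (Continuous.tendsto' (by fun_prop) _ _ (by simp)), ?_⟩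
      filter_upwards [self_mem_nhdsWithin] with τ hτ
      exact mul_pos (Real.sqrt_pos.2 hτ) hr₀
    have hK := (bk_tendsto.comp hsq).inv_tendsto_atTop
    have hlim : Tendsto (fun τ : ℝ => M / r * Real.exp ((Real.sqrt τ * r₀ / 2) ^ 2) *
        (besselK 0 (Real.sqrt τ * r₀))⁻¹) (nhdsWithin 0 (Set.Ioi 0)) (nhds 0) := by
      simpa using (hexp.const_mul (M / r)).mul hK
    refine squeeze_zero_norm' ?_ hlim
    filter_upwards [self_mem_nhdsWithin] with τ hτ
    have hτ' : 0 < τ := hτ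
    have hx : 0 < Real.sqrt τ := Real.sqrt_pos.2 hτ'
    have hxx : Real.sqrt τ * Real.sqrt τ = τ := Real.mul_self_sqrt hτ'.le
    refine (key τ hτ').trans ?_
    simp only [besselIm1, besselKm1, one_ne_zero, if_false, Nat.sub_self]
    have hI := bi_le 0 (Real.sqrt τ * r₀) (by positivity)
    have hI0 := bi_nonneg 0 (Real.sqrt τ * r₀) (by positivity)
    have hK1 := bk_le 1 le_rfl (Real.sqrt τ * r) (by positivity)
    have hK0 := bk_nonneg 0 (Real.sqrt τ * r₀)
    rw [pow_zero, one_mul] at hI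
    calc _ ≤ τ * (1 / (Real.sqrt τ * r) * Real.exp ((Real.sqrt τ * r₀ / 2) ^ 2) /
          besselK 0 (Real.sqrt τ * r₀) * (M / Real.sqrt τ)) := by gcongr
      _ = (τ / (Real.sqrt τ * Real.sqrt τ)) * (M / r * Real.exp ((Real.sqrt τ * r₀ / 2) ^ 2) *
          (besselK 0 (Real.sqrt τ * r₀))⁻¹) := by
        simp only [div_eq_mul_inv, mul_inv]; ring
      _ = _ := by rw [hxx, div_self hτ'.ne', one_mul]
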